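/- arXiv:2111.08399 — 2 statements merged into one kernel-verified Lean document; each statement's English description precedes it below -/
import Mathlib

section
/- Let V be a 6-dimensional real vector space with basis v₁,…,v₆ and dual basis v¹,…,v⁶, and let V_e, V_f, V_g be three copies of V with bases e_i, f_i, g_i. For any τ ∈ Λ³V*, with τ_e, τ_f the corresponding 3-forms on the copies, the following identity holds in Λ((V_e ⊕ V_f ⊕ V_g)*): τ_e ∧ C_{gfe} ∧ τ_f = −Σ_{ℓ=1}^{6} g^ℓ ∧ k_{τ_f}(f_ℓ) ∧ vol_e, where k_{τ_f}(f_ℓ) = ι_{f_ℓ} τ_f ∧ τ_f and vol_e = e¹∧…∧e⁶. -/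
set_option synthInstance.maxHeartbeats 1000000
set_option maxHeartbeats 1000000

open ExteriorAlgebra Module

noncomputable section

/-- The degree-`k` homogeneous component of the exterior algebra of `V`. -/
def degPart (V : Type*) [AddCommGroup V] [Module ℝ V] (k : ℕ) :
    Submodule ℝ (ExteriorAlgebra ℝ V) :=
  LinearMap.range (ExteriorAlgebra.ι ℝ : V →ₗ[ℝ] ExteriorAlgebra ℝ V) ^ k

/-- `c` is the interior product (contraction) with the vector `X : V` on `Λ V*`. -/
def IsContraction {V : Type*} [AddCommGroup V] [Module ℝ V] (X : V)
    (c : ExteriorAlgebra ℝ (Dual ℝ V) →ₗ[ℝ] ExteriorAlgebra ℝ (Dual ℝ V)) : Prop :=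
  (∀ k, ∀ x ∈ degPart (Dual ℝ V) k, ∀ y,
      c (x * y) = c x * y + ((-1 : ℝ)) ^ k • (x * c y)) ∧
  (∀ α : Dual ℝ V, c (ExteriorAlgebra.ι ℝ α) = algebraMap ℝ _ (α X))

variable {V : Type*} [AddCommGroup V] [Module ℝ V]

/-- The 1-form `x^j` on the direct sum of `m` copies of `V`: the pullback of the `j`-th dual
basis vector under the projection onto the `x`-th copy. -/
def copyForm (m : ℕ) (b : Basis (Fin 6) ℝ V) (x : Fin m) (j : Fin 6) :
    ExteriorAlgebra ℝ (Dual ℝ (Fin m → V)) :=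
  ExteriorAlgebra.ι ℝ ((LinearMap.proj x : (Fin m → V) →ₗ[ℝ] V).dualMap (b.dualBasis j))

/-- The image `τ_x` of a form `τ ∈ Λ V*` in the `x`-th copy inside `Λ ((V_0 ⊕ ⋯ ⊕ V_{m-1})*)`. -/
def copyMap (m : ℕ) (x : Fin m) :
    ExteriorAlgebra ℝ (Dual ℝ V) →ₐ[ℝ] ExteriorAlgebra ℝ (Dual ℝ (Fin m → V)) :=
  ExteriorAlgebra.map (LinearMap.proj x : (Fin m → V) →ₗ[ℝ] V).dualMap

/-- The element `C_{xyz} = Σ_σ (-1)^σ x^i ∧ y^j ∧ y^k ∧ z^r ∧ z^s ∧ z^t`, the sum running over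
all (1,2,3)-shuffles `σ = {{i},{j,k},{r,s,t}}` of `{1,…,6}`.  Since each shuffle corresponds to
exactly `2!·3! = 12` permutations of `Fin 6`, all contributing equally, it can be written as
`(1/12) Σ_{σ ∈ S₆} sgn(σ) x^{σ(1)} ∧ y^{σ(2)} ∧ y^{σ(3)} ∧ z^{σ(4)} ∧ z^{σ(5)} ∧ z^{σ(6)}`. -/
def shuffleForm (m : ℕ) (b : Basis (Fin 6) ℝ V) (x y z : Fin m) :
    ExteriorAlgebra ℝ (Dual ℝ (Fin m → V)) :=
  (12⁻¹ : ℝ) • ∑ σ : Equiv.Perm (Fin 6), ((Equiv.Perm.sign σ : ℤ) : ℝ) •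
    (copyForm m b x (σ 0) * copyForm m b y (σ 1) * copyForm m b y (σ 2) *
     copyForm m b z (σ 3) * copyForm m b z (σ 4) * copyForm m b z (σ 5))

/-- The volume form `x¹ ∧ ⋯ ∧ x⁶` of the `x`-th copy. -/
def copyVol (m : ℕ) (b : Basis (Fin 6) ℝ V) (x : Fin m) :
    ExteriorAlgebra ℝ (Dual ℝ (Fin m → V)) :=
  (List.ofFn fun j : Fin 6 => copyForm m b x j).prod

/-- The volume form `v¹ ∧ ⋯ ∧ v⁶ ∈ Λ⁶ V*`. -/
def volForm (b : Basis (Fin 6) ℝ V) : ExteriorAlgebra ℝ (Dual ℝ V) :=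
  (List.ofFn fun j : Fin 6 => ExteriorAlgebra.ι ℝ (b.dualBasis j)).prod


section Shuffle

variable {M : Type*} [AddCommGroup M] [Module ℝ M]

local notation "ε" => ExteriorAlgebra.ι ℝ

theorem ι_mul_ι_swap (x y : M) : ε x * ε y = -(ε y * ε x) :=
  eq_neg_of_add_eq_zero_left (ExteriorAlgebra.ι_add_mul_swap x y)

theorem ιMulti_three (v : Fin 3 → M) :
    ExteriorAlgebra.ιMulti ℝ 3 v = ε (v 0) * ε (v 1) * ε (v 2) := by
  simp only [ExteriorAlgebra.ιMulti_apply, List.ofFn_succ, List.ofFn_zero, List.prod_cons,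
    List.prod_nil, mul_one, mul_assoc]
  rfl

theorem ιMulti_six (v : Fin 6 → M) :
    ExteriorAlgebra.ιMulti ℝ 6 v =
      ε (v 0) * ε (v 1) * ε (v 2) * ε (v 3) * ε (v 4) * ε (v 5) := by
  simp only [ExteriorAlgebra.ιMulti_apply, List.ofFn_succ, List.ofFn_zero, List.prod_cons,
    List.prod_nil, mul_one, mul_assoc]
  rfl

/-- The part of a product of three covectors `x i`, `x j`, `x k` in which one factor is taken
from `g` and the other two from `f`, with the signs of the corresponding shuffles. -/
def oneTwoShuffle (g f : Fin 6 → M) (i j k : Fin 6) : ExteriorAlgebra ℝ M :=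
  ε (g i) * ε (f j) * ε (f k) - ε (g j) * ε (f i) * ε (f k) + ε (g k) * ε (f i) * ε (f j)

theorem oneTwoShuffle_eq_zero_of_not_injective (g f : Fin 6 → M) (i j k : Fin 6)
    (h : ¬ Function.Injective ![i, j, k]) : oneTwoShuffle g f i j k = 0 := by
  have h' : i = j ∨ j = k ∨ i = k := by
    by_contra! hne
    obtain ⟨h1, h2, h3⟩ := hne
    refine h fun p q hpq => ?_
    fin_cases p <;> fin_cases q <;> simp_all
  rcases h' with rfl | rfl | rfl
  · simp [oneTwoShuffle, mul_assoc]
  · simp [oneTwoShuffle, mul_assoc]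
  · simp [oneTwoShuffle, mul_assoc, ι_mul_ι_swap (f i) (f j)]

theorem sum_sign_perm_three (g f : Fin 6 → M) (c : Fin 3 → Fin 6) :
    ∑ s : Equiv.Perm (Fin 3), ((Equiv.Perm.sign s : ℤ) : ℝ) •
      (ε (g (c (s 0))) * ε (f (c (s 1))) * ε (f (c (s 2)))) =
    (2 : ℝ) • oneTwoShuffle g f (c 0) (c 1) (c 2) := by
  have hu : (Finset.univ : Finset (Equiv.Perm (Fin 3))) =
      {1, Equiv.swap 0 1, Equiv.swap 0 2, Equiv.swap 1 2,
        Equiv.swap 0 1 * Equiv.swap 1 2, Equiv.swap 1 2 * Equiv.swap 0 1} := by decide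
  have h01 : (Equiv.swap (0 : Fin 3) 1) 2 = 2 := by decide
  have h02 : (Equiv.swap (0 : Fin 3) 2) 1 = 1 := by decide
  have h12 : (Equiv.swap (1 : Fin 3) 2) 0 = 0 := by decide
  rw [hu]
  repeat rw [Finset.sum_insert (by decide)]
  rw [Finset.sum_singleton]
  simp only [Equiv.Perm.sign_mul, Equiv.Perm.sign_one,
    Equiv.Perm.sign_swap (show (0 : Fin 3) ≠ 1 by decide),
    Equiv.Perm.sign_swap (show (0 : Fin 3) ≠ 2 by decide),
    Equiv.Perm.sign_swap (show (1 : Fin 3) ≠ 2 by decide),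
    Equiv.Perm.mul_apply, Equiv.Perm.one_apply, Equiv.swap_apply_left, Equiv.swap_apply_right,
    h01, h02, h12, oneTwoShuffle, mul_assoc, ι_mul_ι_swap (f (c 1)) (f (c 0)),
    ι_mul_ι_swap (f (c 2)) (f (c 0)), ι_mul_ι_swap (f (c 2)) (f (c 1))]
  simp only [two_smul, mul_neg, Units.val_one, Units.val_neg, Int.cast_one, Int.cast_neg,
    one_smul, neg_smul, neg_neg, mul_one]
  abel

/-- The permutation of `Fin 6` acting by `s` on `{0, 1, 2}` and by `t` on `{3, 4, 5}`. -/
def blockPerm (p : Equiv.Perm (Fin 3) × Equiv.Perm (Fin 3)) : Equiv.Perm (Fin 6) :=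
  (finSumFinEquiv (m := 3) (n := 3)).permCongr (Equiv.Perm.sumCongr p.1 p.2)

theorem blockPerm_castAdd (p : Equiv.Perm (Fin 3) × Equiv.Perm (Fin 3)) (i : Fin 3) :
    blockPerm p (Fin.castAdd 3 i) = Fin.castAdd 3 (p.1 i) :=
  congrArg (fun z => finSumFinEquiv (Sum.map p.1 p.2 z)) (finSumFinEquiv_symm_apply_castAdd i)

theorem blockPerm_natAdd (p : Equiv.Perm (Fin 3) × Equiv.Perm (Fin 3)) (i : Fin 3) :
    blockPerm p (Fin.natAdd 3 i) = Fin.natAdd 3 (p.2 i) :=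
  congrArg (fun z => finSumFinEquiv (Sum.map p.1 p.2 z)) (finSumFinEquiv_symm_apply_natAdd i)

theorem sign_blockPerm (p : Equiv.Perm (Fin 3) × Equiv.Perm (Fin 3)) :
    Equiv.Perm.sign (blockPerm p) = Equiv.Perm.sign p.1 * Equiv.Perm.sign p.2 := by
  simp [blockPerm, Equiv.Perm.sign_permCongr, Equiv.Perm.sign_sumCongr]

theorem blockPerm_injective : Function.Injective blockPerm :=
  (Equiv.injective _).comp Equiv.Perm.sumCongrHom_injective

theorem mem_range_blockPerm (σ : Equiv.Perm (Fin 6)) (h3 : 3 ≤ (σ 3).val) (h4 : 3 ≤ (σ 4).val)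
    (h5 : 3 ≤ (σ 5).val) : σ ∈ Set.range blockPerm := by
  have key : ∀ i : Fin 6, i.val < 3 → (σ i).val < 3 := by
    intro i hi
    have hne : ∀ j : Fin 6, 3 ≤ j.val → (σ i).val ≠ (σ j).val := fun j hj h => by
      have := σ.injective (Fin.ext h)
      omega
    have h34 : (σ 3).val ≠ (σ 4).val := fun h => by simpa using σ.injective (Fin.ext h)
    have h35 : (σ 3).val ≠ (σ 5).val := fun h => by simpa using σ.injective (Fin.ext h)
    have h45 : (σ 4).val ≠ (σ 5).val := fun h => by simpa using σ.injective (Fin.ext h)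
    have i3 := hne 3 (by decide)
    have i4 := hne 4 (by decide)
    have i5 := hne 5 (by decide)
    omega
  let e := finSumFinEquiv (m := 3) (n := 3)
  obtain ⟨p, hp⟩ := Equiv.Perm.mem_sumCongrHom_range_of_perm_mapsTo_inl
    (σ := e.symm.permCongr σ) (by
      rintro _ ⟨i, rfl⟩
      have := key (Fin.castAdd 3 i) i.isLt
      refine ⟨⟨_, this⟩, ?_⟩
      rw [Equiv.permCongr_apply, Equiv.eq_symm_apply]
      exact congrArg σ (finSumFinEquiv_apply_left i).symm)
  refine ⟨p, ?_⟩
  have : blockPerm p = e.permCongr (e.symm.permCongr σ) := by rw [← hp]; rfl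
  rw [this]
  ext i
  simp [Equiv.permCongr_apply]

theorem ι_triple_mul_swap (u v w x y z : M) (q : ExteriorAlgebra ℝ M) :
    ε u * ε v * ε w * (ε x * ε y * ε z * q) = -(ε x * ε y * ε z * (ε u * ε v * ε w * q)) := by
  have h : ∀ s t : M, ∀ p : ExteriorAlgebra ℝ M, ε s * (ε t * p) = -(ε t * (ε s * p)) := by
    intro s t p
    rw [← mul_assoc, ι_mul_ι_swap, neg_mul, mul_assoc]
  simp only [mul_assoc]
  rw [h w x, h w y, h w z]
  simp only [mul_neg]
  rw [h v x, h v y, h v z]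
  simp only [mul_neg]
  rw [h u x, h u y, h u z]
  simp only [mul_neg, neg_neg]

theorem triple_mul_sum_shuffle (e f g : Fin 6 → M) :
    ε (e 0) * ε (e 1) * ε (e 2) *
      ∑ σ : Equiv.Perm (Fin 6), ((Equiv.Perm.sign σ : ℤ) : ℝ) •
        (ε (g (σ 0)) * ε (f (σ 1)) * ε (f (σ 2)) * ε (e (σ 3)) * ε (e (σ 4)) * ε (e (σ 5))) =
    -((12 : ℝ) • (oneTwoShuffle g f 0 1 2 * ExteriorAlgebra.ιMulti ℝ 6 e)) := by
  have hterm : ∀ σ : Equiv.Perm (Fin 6), ε (e 0) * ε (e 1) * ε (e 2) *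
      (((Equiv.Perm.sign σ : ℤ) : ℝ) •
        (ε (g (σ 0)) * ε (f (σ 1)) * ε (f (σ 2)) * ε (e (σ 3)) * ε (e (σ 4)) * ε (e (σ 5)))) =
      -(((Equiv.Perm.sign σ : ℤ) : ℝ) • (ε (g (σ 0)) * ε (f (σ 1)) * ε (f (σ 2)) *
        ExteriorAlgebra.ιMulti ℝ 6 (e ∘ ![0, 1, 2, σ 3, σ 4, σ 5]))) := by
    intro σ
    have h := ι_triple_mul_swap (e 0) (e 1) (e 2) (g (σ 0)) (f (σ 1)) (f (σ 2))
      (ε (e (σ 3)) * ε (e (σ 4)) * ε (e (σ 5)))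
    rw [mul_smul_comm, ← smul_neg]
    congr 1
    rw [ιMulti_six]
    simpa [mul_assoc] using h
  rw [Finset.mul_sum, Finset.sum_congr rfl fun σ _ => hterm σ, Finset.sum_neg_distrib]
  refine congrArg Neg.neg ?_
  rw [← Fintype.sum_of_injective blockPerm blockPerm_injective
    (fun p => ((Equiv.Perm.sign p.1 : ℤ) : ℝ) • (ε (g (Fin.castAdd 3 (p.1 0))) *
      ε (f (Fin.castAdd 3 (p.1 1))) * ε (f (Fin.castAdd 3 (p.1 2)))) *
      ExteriorAlgebra.ιMulti ℝ 6 e)]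
  · rw [Fintype.sum_prod_type]
    simp only [Finset.sum_const, Finset.card_univ, Fintype.card_perm, Fintype.card_fin]
    rw [← Finset.smul_sum, ← Finset.sum_mul, sum_sign_perm_three g f (Fin.castAdd 3),
      smul_mul_assoc, ← Nat.cast_smul_eq_nsmul ℝ, smul_smul]
    norm_num [Nat.factorial]
    rfl
  · intro σ hσ
    have : ¬ Function.Injective (e ∘ ![0, 1, 2, σ 3, σ 4, σ 5]) := by
      intro hinj
      have hw := hinj.of_comp
      apply hσ
      have hge : ∀ j : Fin 6, 3 ≤ j.val →
          3 ≤ ((![0, 1, 2, σ 3, σ 4, σ 5] : Fin 6 → Fin 6) j).val := by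
        intro j hj
        have h0 : (![0, 1, 2, σ 3, σ 4, σ 5] : Fin 6 → Fin 6) j ≠ 0 := fun h => by
          have := @hw j 0 h
          subst this
          simp at hj
        have h1 : (![0, 1, 2, σ 3, σ 4, σ 5] : Fin 6 → Fin 6) j ≠ 1 := fun h => by
          have := @hw j 1 h
          subst this
          simp at hj
        have h2 : (![0, 1, 2, σ 3, σ 4, σ 5] : Fin 6 → Fin 6) j ≠ 2 := fun h => by
          have := @hw j 2 h
          subst this
          simp at hj
        omega
      exact mem_range_blockPerm σ (hge 3 (by decide)) (hge 4 (by decide)) (hge 5 (by decide))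
    rw [AlternatingMap.map_eq_zero_of_not_injective _ _ this, mul_zero, smul_zero]
  · intro p
    have hw : (![0, 1, 2, blockPerm p 3, blockPerm p 4, blockPerm p 5] : Fin 6 → Fin 6) =
        blockPerm (1, p.2) := by
      funext j
      fin_cases j
      · exact (blockPerm_castAdd (1, p.2) 0).symm
      · exact (blockPerm_castAdd (1, p.2) 1).symm
      · exact (blockPerm_castAdd (1, p.2) 2).symm
      · exact (blockPerm_natAdd p 0).trans (blockPerm_natAdd (1, p.2) 0).symm
      · exact (blockPerm_natAdd p 1).trans (blockPerm_natAdd (1, p.2) 1).symm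
      · exact (blockPerm_natAdd p 2).trans (blockPerm_natAdd (1, p.2) 2).symm
    have h0 : blockPerm p 0 = Fin.castAdd 3 (p.1 0) := blockPerm_castAdd p 0
    have h1 : blockPerm p 1 = Fin.castAdd 3 (p.1 1) := blockPerm_castAdd p 1
    have h2 : blockPerm p 2 = Fin.castAdd 3 (p.1 2) := blockPerm_castAdd p 2
    rw [hw, AlternatingMap.map_perm, sign_blockPerm, sign_blockPerm, h0, h1, h2]
    rcases Int.units_eq_one_or (Equiv.Perm.sign p.2) with h | h <;> simp [h]

/-- Multiplying a product of three covectors with the `(1,2,3)`-shuffle sum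
completes the last three factors to a volume form. -/
theorem triple_mul_sum_shuffle_apply (e f g : Fin 6 → M) (i j k : Fin 6) :
    ε (e i) * ε (e j) * ε (e k) *
      ∑ σ : Equiv.Perm (Fin 6), ((Equiv.Perm.sign σ : ℤ) : ℝ) •
        (ε (g (σ 0)) * ε (f (σ 1)) * ε (f (σ 2)) * ε (e (σ 3)) * ε (e (σ 4)) * ε (e (σ 5))) =
    -((12 : ℝ) • (oneTwoShuffle g f i j k * ExteriorAlgebra.ιMulti ℝ 6 e)) := by
  by_cases hinj : Function.Injective ![i, j, k]
  · obtain ⟨ρ, hρ⟩ : ∃ ρ : Equiv.Perm (Fin 6), ρ 0 = i ∧ ρ 1 = j ∧ ρ 2 = k := by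
      have := Equiv.Perm.isMultiplyPretransitive (Fin 6) 3
      obtain ⟨ρ, hρ⟩ := MulAction.exists_smul_eq (Equiv.Perm (Fin 6))
        (Fin.castAddEmb 3 : Fin 3 ↪ Fin 6) ⟨![i, j, k], hinj⟩
      exact ⟨ρ, DFunLike.congr_fun hρ 0, DFunLike.congr_fun hρ 1, DFunLike.congr_fun hρ 2⟩
    obtain ⟨rfl, rfl, rfl⟩ := hρ
    have h := triple_mul_sum_shuffle (e ∘ ρ) (f ∘ ρ) (g ∘ ρ)
    rw [AlternatingMap.map_perm] at h
    rw [← Equiv.sum_comp (Equiv.mulLeft ρ)]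
    simp only [Equiv.coe_mulLeft, Equiv.Perm.mul_apply, Equiv.Perm.sign_mul]
    simp only [Function.comp_apply] at h
    change _ = -((12 : ℝ) • (oneTwoShuffle g f (ρ 0) (ρ 1) (ρ 2) * _)) at h
    rcases Int.units_eq_one_or (Equiv.Perm.sign ρ) with hs | hs
    · simpa [hs] using h
    · simpa [hs] using h
  · have h0 : ε (e i) * ε (e j) * ε (e k) = 0 := by
      have := (ExteriorAlgebra.ιMulti ℝ 3).map_eq_zero_of_not_injective (e ∘ ![i, j, k])
        fun h => hinj h.of_comp
      rw [ιMulti_three] at this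
      simpa [mul_assoc] using this
    rw [h0, oneTwoShuffle_eq_zero_of_not_injective g f i j k hinj]
    simp

theorem ιMulti_six_commute (e : Fin 6 → M) (x : ExteriorAlgebra ℝ M) :
    Commute (ExteriorAlgebra.ιMulti ℝ 6 e) x := by
  induction x using ExteriorAlgebra.induction with
  | algebraMap r => exact (Algebra.commutes r _).symm
  | ι y =>
    simp only [ExteriorAlgebra.ιMulti_apply, List.ofFn_succ, List.ofFn_zero, List.prod_cons,
      List.prod_nil, mul_one]
    have h : ∀ z : M, ∀ q : ExteriorAlgebra ℝ M, ε z * (ε y * q) = -(ε y * (ε z * q)) := by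
      intro z q
      rw [← mul_assoc, ι_mul_ι_swap, neg_mul, mul_assoc]
    simp only [Commute, SemiconjBy, mul_assoc, h, ι_mul_ι_swap _ y, mul_neg, neg_neg]
  | mul a b ha hb => exact ha.mul_right hb
  | add a b ha hb => exact ha.add_right hb

end Shuffle

theorem IsContraction.apply_ι_mul {X : V}
    {c : ExteriorAlgebra ℝ (Dual ℝ V) →ₗ[ℝ] ExteriorAlgebra ℝ (Dual ℝ V)}
    (hc : IsContraction X c) (α : Dual ℝ V) (y : ExteriorAlgebra ℝ (Dual ℝ V)) :
    c (ExteriorAlgebra.ι ℝ α * y) = α X • y - ExteriorAlgebra.ι ℝ α * c y := by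
  rw [hc.1 1 _ (by rw [degPart, pow_one]; exact ⟨α, rfl⟩), pow_one, neg_one_smul, hc.2,
    ← sub_eq_add_neg, ← Algebra.smul_def]

theorem IsContraction.apply_ι_triple {X : V}
    {c : ExteriorAlgebra ℝ (Dual ℝ V) →ₗ[ℝ] ExteriorAlgebra ℝ (Dual ℝ V)}
    (hc : IsContraction X c) (α β γ : Dual ℝ V) :
    c (ExteriorAlgebra.ι ℝ α * ExteriorAlgebra.ι ℝ β * ExteriorAlgebra.ι ℝ γ) =
      α X • (ExteriorAlgebra.ι ℝ β * ExteriorAlgebra.ι ℝ γ) -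
      β X • (ExteriorAlgebra.ι ℝ α * ExteriorAlgebra.ι ℝ γ) +
      γ X • (ExteriorAlgebra.ι ℝ α * ExteriorAlgebra.ι ℝ β) := by
  rw [mul_assoc, hc.apply_ι_mul, hc.apply_ι_mul, hc.2, ← Algebra.commutes, ← Algebra.smul_def,
    mul_sub, mul_smul_comm, mul_smul_comm]
  abel

open Pointwise in
theorem degPart_three_eq_span {ι : Type*} (b : Basis ι ℝ V) :
    degPart V 3 = Submodule.span ℝ (Set.range fun p : ι × ι × ι =>
      ExteriorAlgebra.ι ℝ (b p.1) * ExteriorAlgebra.ι ℝ (b p.2.1) *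
        ExteriorAlgebra.ι ℝ (b p.2.2)) := by
  have h : LinearMap.range (ExteriorAlgebra.ι ℝ : V →ₗ[ℝ] ExteriorAlgebra ℝ V) =
      Submodule.span ℝ (Set.range fun i => ExteriorAlgebra.ι ℝ (b i)) := by
    rw [LinearMap.range_eq_map, ← b.span_eq, Submodule.map_span, ← Set.range_comp]
    rfl
  rw [degPart, h, Submodule.span_pow]
  congr 1
  ext x
  simp only [pow_succ, pow_zero, one_mul, Set.mem_mul, Set.mem_range, Prod.exists]
  constructor
  · rintro ⟨_, ⟨_, ⟨i, rfl⟩, _, ⟨j, rfl⟩, rfl⟩, _, ⟨k, rfl⟩, rfl⟩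
    exact ⟨i, j, k, rfl⟩
  · rintro ⟨i, j, k, rfl⟩
    exact ⟨_, ⟨_, ⟨i, rfl⟩, _, ⟨j, rfl⟩, rfl⟩, _, ⟨k, rfl⟩, rfl⟩

/-- The covector `x^j` underlying `copyForm`. -/
def copyCovector (m : ℕ) (b : Basis (Fin 6) ℝ V) (x : Fin m) (j : Fin 6) :
    Dual ℝ (Fin m → V) :=
  (LinearMap.proj x : (Fin m → V) →ₗ[ℝ] V).dualMap (b.dualBasis j)

theorem copyVol_eq_ιMulti (m : ℕ) (b : Basis (Fin 6) ℝ V) (x : Fin m) :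
    copyVol m b x = ExteriorAlgebra.ιMulti ℝ 6 (copyCovector m b x) := by
  rw [ExteriorAlgebra.ιMulti_apply]
  rfl

theorem copyMap_triple (m : ℕ) (b : Basis (Fin 6) ℝ V) (x : Fin m) (i j k : Fin 6) :
    copyMap m x (ExteriorAlgebra.ι ℝ (b.dualBasis i) * ExteriorAlgebra.ι ℝ (b.dualBasis j) *
      ExteriorAlgebra.ι ℝ (b.dualBasis k)) =
    ExteriorAlgebra.ι ℝ (copyCovector m b x i) * ExteriorAlgebra.ι ℝ (copyCovector m b x j) *
      ExteriorAlgebra.ι ℝ (copyCovector m b x k) := by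
  simp [copyMap, copyCovector]

theorem copyCovector_single (m : ℕ) (b : Basis (Fin 6) ℝ V) (x : Fin m) (i l : Fin 6) :
    copyCovector m b x i (Pi.single x (b l)) = if l = i then 1 else 0 := by
  simp [copyCovector, Finsupp.single_apply]

theorem sum_copyForm_mul_contraction (b : Basis (Fin 6) ℝ V)
    (C : (Fin 3 → V) →
      (ExteriorAlgebra ℝ (Dual ℝ (Fin 3 → V)) →ₗ[ℝ] ExteriorAlgebra ℝ (Dual ℝ (Fin 3 → V))))
    (hC : ∀ X : Fin 3 → V, IsContraction X (C X)) (x y : Fin 3) (i j k : Fin 6) :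
    ∑ l : Fin 6, copyForm 3 b x l * C (Pi.single y (b l))
      (ExteriorAlgebra.ι ℝ (copyCovector 3 b y i) * ExteriorAlgebra.ι ℝ (copyCovector 3 b y j) *
        ExteriorAlgebra.ι ℝ (copyCovector 3 b y k)) =
    oneTwoShuffle (copyCovector 3 b x) (copyCovector 3 b y) i j k := by
  simp only [(hC _).apply_ι_triple, copyCovector_single, mul_add, mul_sub, ite_smul, one_smul,
    zero_smul, mul_ite, mul_zero, Finset.sum_add_distrib, Finset.sum_sub_distrib,
    Finset.sum_ite_eq', Finset.mem_univ, if_true, oneTwoShuffle, ← mul_assoc]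
  rfl

/-- For a `3`-form `τ`, `τ_e ∧ C_{gfe} = -Σ_ℓ g^ℓ ∧ ι_{f_ℓ} τ_f ∧ vol_e`. -/
theorem copyMap_mul_shuffleForm (b : Basis (Fin 6) ℝ V)
    (τ : ExteriorAlgebra ℝ (Dual ℝ V)) (hτ : τ ∈ degPart (Dual ℝ V) 3)
    (C : (Fin 3 → V) →
      (ExteriorAlgebra ℝ (Dual ℝ (Fin 3 → V)) →ₗ[ℝ] ExteriorAlgebra ℝ (Dual ℝ (Fin 3 → V))))
    (hC : ∀ X : Fin 3 → V, IsContraction X (C X)) :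
    copyMap 3 0 τ * shuffleForm 3 b 2 1 0 =
      -((∑ l : Fin 6, copyForm 3 b 2 l * C (Pi.single (1 : Fin 3) (b l)) (copyMap 3 1 τ)) *
        copyVol 3 b 0) := by
  rw [degPart_three_eq_span b.dualBasis] at hτ
  induction hτ using Submodule.span_induction with
  | mem x hx =>
    obtain ⟨⟨i, j, k⟩, rfl⟩ := hx
    dsimp only
    rw [copyMap_triple, copyMap_triple, sum_copyForm_mul_contraction b C hC, copyVol_eq_ιMulti,
      shuffleForm, mul_smul_comm]
    have h := triple_mul_sum_shuffle_apply (copyCovector 3 b 0) (copyCovector 3 b 1)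
      (copyCovector 3 b 2) i j k
    refine (congrArg ((12⁻¹ : ℝ) • ·) h).trans ?_
    simp only [smul_neg, smul_smul]
    norm_num
  | zero => simp
  | add x y _ _ hx hy =>
    simp only [map_add, add_mul, mul_add, Finset.sum_add_distrib, hx, hy, neg_add]
  | smul r x _ hx =>
    simp only [map_smul, smul_mul_assoc, mul_smul_comm, ← Finset.smul_sum, hx, smul_neg]

/-- formula `eqn:formula`.  With copies `e = 0`, `f = 1`, `g = 2` of the
6-dimensional space `V`, for any 3-form `τ`:
`τ_e ∧ C_{gfe} ∧ τ_f = -Σ_ℓ g^ℓ ∧ k_{τ_f}(f_ℓ) ∧ vol_e`,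
where `k_{τ_f}(f_ℓ) = ι_{f_ℓ} τ_f ∧ τ_f` and `f_ℓ` is the `ℓ`-th basis vector of the copy `f`. -/
theorem formula_Cgfe (b : Basis (Fin 6) ℝ V)
    (τ : ExteriorAlgebra ℝ (Dual ℝ V)) (hτ : τ ∈ degPart (Dual ℝ V) 3)
    (C : (Fin 3 → V) →
      (ExteriorAlgebra ℝ (Dual ℝ (Fin 3 → V)) →ₗ[ℝ] ExteriorAlgebra ℝ (Dual ℝ (Fin 3 → V))))
    (hC : ∀ X : Fin 3 → V, IsContraction X (C X)) :
    copyMap 3 0 τ * shuffleForm 3 b 2 1 0 * copyMap 3 1 τ =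
      -∑ ℓ : Fin 6, copyForm 3 b 2 ℓ *
        (C (Pi.single (1 : Fin 3) (b ℓ)) (copyMap 3 1 τ) * copyMap 3 1 τ) * copyVol 3 b 0 := by
  rw [copyMap_mul_shuffleForm b τ hτ C hC, neg_mul, mul_assoc, copyVol_eq_ιMulti,
    (ιMulti_six_commute _ _).eq, ← mul_assoc, Finset.sum_mul, Finset.sum_mul]
  simp only [mul_assoc]
end
end

section
/- Let g be a 7-dimensional real Lie algebra with basis e₁,…,e₇ (dual basis e¹,…,e⁷) such that e₇ is central, and let h* = span(e¹,…,e⁶) ⊂ g* (a d-stable subspace, since e₇ is central). Suppose W ⊆ Λ⁵h* is a linear subspace such that: (i) β ∧ dβ ∈ W for every β ∈ Λ²h*; and (ii) τ ∧ de^j ∈ W for every d-closed τ ∈ Λ³h* and every j = 1,…,6. If, in addition, every d-closed τ ∈ Λ³h* with τ ∧ de⁷ ∈ W has nonnegative Hitchin invariant λ(τ) ≥ 0 (computed on the 6-dimensional space span(e₁,…,e₆)), then g does not admit a coclosed G2-structure. (Proposition 'prop:third' of the paper, the third obstruction.) -/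
set_option synthInstance.maxHeartbeats 1000000
set_option maxHeartbeats 1000000

open ExteriorAlgebra Module

noncomputable section

variable {g : Type*} [LieRing g] [LieAlgebra ℝ g]

/-- `d` is the Chevalley–Eilenberg differential of `g` on `Λ g*`, expressed with respect to a
basis `b` of `g`: it raises degree by one, is an odd derivation, and on 1-forms it is given by
`dα = -Σ_{i<j} α([b i, b j]) bⁱ ∧ bʲ` (which encodes `dα(x,y) = -α([x,y])`). -/
def IsCEDifferential {n : ℕ} (b : Basis (Fin n) ℝ g)
    (d : ExteriorAlgebra ℝ (Dual ℝ g) →ₗ[ℝ] ExteriorAlgebra ℝ (Dual ℝ g)) : Prop :=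
  (∀ k, ∀ x ∈ degPart (Dual ℝ g) k, d x ∈ degPart (Dual ℝ g) (k + 1)) ∧
  (∀ k, ∀ x ∈ degPart (Dual ℝ g) k, ∀ y,
      d (x * y) = d x * y + ((-1 : ℝ)) ^ k • (x * d y)) ∧
  (∀ α : Dual ℝ g, d (ExteriorAlgebra.ι ℝ α) =
    (-(2⁻¹ : ℝ)) • ∑ i, ∑ j, α ⁅b i, b j⁆ •
      (ExteriorAlgebra.ι ℝ (b.dualBasis i) * ExteriorAlgebra.ι ℝ (b.dualBasis j)))

/-- The 4-form `∗φ = e^{1234}+e^{1256}+e^{1367}+e^{1457}+e^{2357}-e^{2467}+e^{3456}` built out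
of a family `f` of seven 1-forms (indexed from 0). -/
def starPhiForm {W : Type*} [AddCommGroup W] [Module ℝ W] (f : Fin 7 → W) :
    ExteriorAlgebra ℝ W :=
  let e : Fin 7 → ExteriorAlgebra ℝ W := fun i => ExteriorAlgebra.ι ℝ (f i)
  e 0 * e 1 * e 2 * e 3 + e 0 * e 1 * e 4 * e 5 + e 0 * e 2 * e 5 * e 6 +
    e 0 * e 3 * e 4 * e 6 + e 1 * e 2 * e 4 * e 6 - e 1 * e 3 * e 5 * e 6 +
    e 2 * e 3 * e 4 * e 5

/-- The 3-form `φ = e^{127}+e^{347}+e^{567}+e^{135}-e^{146}-e^{236}-e^{245}` built out of a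
family `f` of seven 1-forms (indexed from 0). -/
def phiG2Form {W : Type*} [AddCommGroup W] [Module ℝ W] (f : Fin 7 → W) :
    ExteriorAlgebra ℝ W :=
  let e : Fin 7 → ExteriorAlgebra ℝ W := fun i => ExteriorAlgebra.ι ℝ (f i)
  e 0 * e 1 * e 6 + e 2 * e 3 * e 6 + e 4 * e 5 * e 6 + e 0 * e 2 * e 4 -
    e 0 * e 3 * e 5 - e 1 * e 2 * e 5 - e 1 * e 3 * e 4

/-- A 7-dimensional real Lie algebra admits a coclosed G₂-structure if there is a basis
`f¹,…,f⁷` of `g*` for which the 4-form `∗φ` is closed for the Chevalley–Eilenberg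
differential. -/
def AdmitsCoclosedG2 (g : Type*) [LieRing g] [LieAlgebra ℝ g] : Prop :=
  ∃ (b : Basis (Fin 7) ℝ g)
    (d : ExteriorAlgebra ℝ (Dual ℝ g) →ₗ[ℝ] ExteriorAlgebra ℝ (Dual ℝ g)),
    IsCEDifferential b d ∧
    ∃ f : Basis (Fin 7) ℝ (Dual ℝ g), d (starPhiForm fun i => f i) = 0

/-- A 7-dimensional real Lie algebra admits a purely coclosed G₂-structure if there is a basis
`f¹,…,f⁷` of `g*` for which `∗φ` is closed and moreover `φ ∧ dφ = 0`. -/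
def AdmitsPurelyCoclosedG2 (g : Type*) [LieRing g] [LieAlgebra ℝ g] : Prop :=
  ∃ (b : Basis (Fin 7) ℝ g)
    (d : ExteriorAlgebra ℝ (Dual ℝ g) →ₗ[ℝ] ExteriorAlgebra ℝ (Dual ℝ g)),
    IsCEDifferential b d ∧
    ∃ f : Basis (Fin 7) ℝ (Dual ℝ g),
      d (starPhiForm fun i => f i) = 0 ∧
      (phiG2Form fun i => f i) * d (phiG2Form fun i => f i) = 0

/-- Given a basis `e₁,…,e₇` of `g`, the degree-`k` part `Λᵏh*` of the exterior algebra on the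
subspace `h* = span(e¹,…,e⁶) ⊂ g*`. -/
def hPart (b : Basis (Fin 7) ℝ g) (k : ℕ) : Submodule ℝ (ExteriorAlgebra ℝ (Dual ℝ g)) :=
  (Submodule.map (ExteriorAlgebra.ι ℝ : Dual ℝ g →ₗ[ℝ] ExteriorAlgebra ℝ (Dual ℝ g))
    (Submodule.span ℝ (Set.range fun i : Fin 6 => b.dualBasis (Fin.castSucc i)))) ^ k

/-- The volume form `e¹ ∧ ⋯ ∧ e⁶ ∈ Λ⁶h*`. -/
def volH (b : Basis (Fin 7) ℝ g) : ExteriorAlgebra ℝ (Dual ℝ g) :=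
  (List.ofFn fun i : Fin 6 => ExteriorAlgebra.ι ℝ (b.dualBasis (Fin.castSucc i))).prod

/-- The form `∗φ` written in terms of seven elements of an algebra. -/
def starPhiWord {A : Type*} [Ring A] (e : Fin 7 → A) : A :=
  e 0 * e 1 * e 2 * e 3 + e 0 * e 1 * e 4 * e 5 + e 0 * e 2 * e 5 * e 6 +
    e 0 * e 3 * e 4 * e 6 + e 1 * e 2 * e 4 * e 6 - e 1 * e 3 * e 5 * e 6 +
    e 2 * e 3 * e 4 * e 5

/-- The form `φ` written in terms of seven elements of an algebra. -/
def phiG2Word {A : Type*} [Ring A] (e : Fin 7 → A) : A :=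
  e 0 * e 1 * e 6 + e 2 * e 3 * e 6 + e 4 * e 5 * e 6 + e 0 * e 2 * e 4 -
    e 0 * e 3 * e 5 - e 1 * e 2 * e 5 - e 1 * e 3 * e 4

/-- The coordinates of the `G₂` cross product on `ℝ⁷`, determined by
`⟨x × y, z⟩ = φ(x, y, z)`. -/
def crossG2 (x y : Fin 7 → ℝ) : Fin 7 → ℝ :=
  ![x 1 * y 6 + x 2 * y 4 - x 3 * y 5 - x 4 * y 2 + x 5 * y 3 - x 6 * y 1,
    -x 0 * y 6 - x 2 * y 5 - x 3 * y 4 + x 4 * y 3 + x 5 * y 2 + x 6 * y 0,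
    -x 0 * y 4 + x 1 * y 5 + x 3 * y 6 + x 4 * y 0 - x 5 * y 1 - x 6 * y 3,
    x 0 * y 5 + x 1 * y 4 - x 2 * y 6 - x 4 * y 1 - x 5 * y 0 + x 6 * y 2,
    x 0 * y 2 - x 1 * y 3 - x 2 * y 0 + x 3 * y 1 + x 5 * y 6 - x 6 * y 5,
    -x 0 * y 3 - x 1 * y 2 + x 2 * y 1 + x 3 * y 0 - x 4 * y 6 + x 6 * y 4,
    x 0 * y 1 - x 1 * y 0 + x 2 * y 3 - x 3 * y 2 + x 4 * y 5 - x 5 * y 4]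

theorem crossG2_crossG2 (x y : Fin 7 → ℝ) (i : Fin 7) :
    crossG2 x (crossG2 x y) i = (∑ j, x j * y j) * x i - (∑ j, x j ^ 2) * y i := by
  fin_cases i <;> simp [crossG2, Fin.sum_univ_seven] <;> ring

section Anticommuting

variable {A : Type*} [Ring A] {e : Fin 7 → A}

theorem sq_mul_of_sq_eq_zero (hsq : ∀ i, e i * e i = 0) (i : Fin 7) (z : A) :
    e i * (e i * z) = 0 := by
  rw [← mul_assoc, hsq, zero_mul]

theorem mul_mul_of_anticommute (hsw : ∀ i j, i < j → e j * e i = -(e i * e j)) (i j : Fin 7)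
    (h : i < j) (z : A) : e j * (e i * z) = -(e i * (e j * z)) := by
  rw [← mul_assoc, hsw i j h, neg_mul, mul_assoc]

theorem sum_sq_smul_starPhiWord [Algebra ℝ A] (hsq : ∀ i, e i * e i = 0)
    (hsw : ∀ i j, i < j → e j * e i = -(e i * e j)) (C : A →ₗ[ℝ] A) (x : Fin 7 → ℝ)
    (hC : ∀ i z, C (e i * z) = x i • z - e i * C z) (hC1 : ∀ i, C (e i) = x i • 1) :
    (∑ i, x i ^ 2) • starPhiWord e =
      (2⁻¹ : ℝ) • (C (phiG2Word e) * C (phiG2Word e)) -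
        C (starPhiWord e) * ∑ i, x i • e i := by
  have hsq' := sq_mul_of_sq_eq_zero hsq
  have hsw' := mul_mul_of_anticommute hsw
  simp only [starPhiWord, phiG2Word, map_add, map_sub, mul_assoc, hC, hC1, Fin.sum_univ_seven]
  generalize x 0 = x0, x 1 = x1, x 2 = x2, x 3 = x3, x 4 = x4, x 5 = x5, x 6 = x6
  simp only [mul_add, add_mul, mul_sub, sub_mul, smul_mul_assoc, mul_smul_comm, mul_assoc, mul_one,
    smul_add, smul_sub, smul_smul]
  simp (discharger := decide) only [hsq, hsq', hsw, hsw', mul_neg, neg_neg, smul_neg, mul_zero,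
    smul_zero, sub_zero]
  module

theorem contract_contract_starPhiWord_mul [Algebra ℝ A] (hsq : ∀ i, e i * e i = 0)
    (hsw : ∀ i j, i < j → e j * e i = -(e i * e j)) (C D G : A →ₗ[ℝ] A) (x y : Fin 7 → ℝ)
    (k : Fin 7) (hy : y = fun i => if i = k then 1 else 0)
    (hC : ∀ i z, C (e i * z) = x i • z - e i * C z) (hC1 : ∀ i, C (e i) = x i • 1)
    (hD : ∀ i z, D (e i * z) = y i • z - e i * D z) (hD1 : ∀ i, D (e i) = y i • 1)
    (hG : ∀ i z, G (e i * z) = crossG2 x y i • z - e i * G z)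
    (hG1 : ∀ i, G (e i) = crossG2 x y i • 1) :
    D (C (starPhiWord e)) * C (starPhiWord e) =
      (-2 : ℝ) • G (C (e 0 * (e 1 * (e 2 * (e 3 * (e 4 * (e 5 * e 6))))))) := by
  have hsq' := sq_mul_of_sq_eq_zero hsq
  have hsw' := mul_mul_of_anticommute hsw
  simp only [starPhiWord, map_add, map_sub, mul_assoc, hC, hC1, mul_smul_comm, mul_one]
  fin_cases k <;>
  · simp only [Fin.reduceFinMk, Fin.zero_eta, Fin.mk_one] at hy
    simp only [hy, crossG2, Fin.reduceEq, ite_true, ite_false, mul_zero, mul_one,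
      add_zero, zero_add, zero_sub, sub_zero] at hD hD1 hG hG1
    simp only [map_sub, map_smul, hD, hD1, hG, hG1, Matrix.cons_val, Fin.reduceEq,
      ite_true, ite_false, mul_zero, zero_sub, sub_zero, one_smul, zero_smul, smul_zero]
    generalize x 0 = x0, x 1 = x1, x 2 = x2, x 3 = x3, x 4 = x4, x 5 = x5, x 6 = x6
    simp only [mul_add, add_mul, mul_sub, sub_mul, smul_mul_assoc, mul_smul_comm, mul_assoc,
      mul_one, smul_add, smul_sub, smul_smul, neg_mul, mul_neg]
    simp (discharger := decide) only [hsq, hsq', hsw, hsw', mul_neg, neg_neg, smul_neg, mul_zero,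
      zero_mul, smul_zero, sub_zero]
    module

end Anticommuting

section Interior

variable {V : Type*} [AddCommGroup V] [Module ℝ V]

/-- The interior product with a vector, as a linear function of the vector. -/
def interiorProduct :
    V →ₗ[ℝ] ExteriorAlgebra ℝ (Dual ℝ V) →ₗ[ℝ] ExteriorAlgebra ℝ (Dual ℝ V) :=
  CliffordAlgebra.contractLeft (Q := 0) ∘ₗ Dual.eval ℝ V

theorem interiorProduct_ι_mul (X : V) (α : Dual ℝ V) (y : ExteriorAlgebra ℝ (Dual ℝ V)) :
    interiorProduct X (ExteriorAlgebra.ι ℝ α * y) = α X • y - ExteriorAlgebra.ι ℝ α * interiorProduct X y :=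
  CliffordAlgebra.contractLeft_ι_mul (Q := 0) _ α y

theorem interiorProduct_algebraMap (X : V) (r : ℝ) :
    interiorProduct X (algebraMap ℝ (ExteriorAlgebra ℝ (Dual ℝ V)) r) = 0 :=
  CliffordAlgebra.contractLeft_algebraMap (Q := 0) _ r

theorem interiorProduct_ι (X : V) (α : Dual ℝ V) :
    interiorProduct X (ExteriorAlgebra.ι ℝ α) = α X • (1 : ExteriorAlgebra ℝ (Dual ℝ V)) := by
  rw [← Algebra.algebraMap_eq_smul_one]
  exact CliffordAlgebra.contractLeft_ι (Q := 0) _ α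

theorem interiorProduct_interiorProduct (X : V) (z : ExteriorAlgebra ℝ (Dual ℝ V)) :
    interiorProduct X (interiorProduct X z) = 0 :=
  CliffordAlgebra.contractLeft_contractLeft (Q := 0) _ z

theorem ι_mem_degPart_one (v : V) : ExteriorAlgebra.ι ℝ v ∈ degPart V 1 := by
  rw [degPart, pow_one]; exact ⟨v, rfl⟩

theorem one_mem_degPart_zero : (1 : ExteriorAlgebra ℝ V) ∈ degPart V 0 := by
  rw [degPart, pow_zero]; exact Submodule.one_le.mp le_rfl

theorem mul_mem_degPart {m n : ℕ} {x y : ExteriorAlgebra ℝ V} (hx : x ∈ degPart V m)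
    (hy : y ∈ degPart V n) : x * y ∈ degPart V (m + n) := by
  rw [degPart, pow_add]; exact Submodule.mul_mem_mul hx hy

theorem starPhiForm_mem_degPart (f : Fin 7 → V) : starPhiForm f ∈ degPart V 4 := by
  have h (i j k l : Fin 7) : ExteriorAlgebra.ι ℝ (f i) * ExteriorAlgebra.ι ℝ (f j) *
      ExteriorAlgebra.ι ℝ (f k) * ExteriorAlgebra.ι ℝ (f l) ∈ degPart V 4 :=
    mul_mem_degPart (mul_mem_degPart (mul_mem_degPart (ι_mem_degPart_one _) (ι_mem_degPart_one _))
      (ι_mem_degPart_one _)) (ι_mem_degPart_one _)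
  exact add_mem (sub_mem (add_mem (add_mem (add_mem (add_mem (h _ _ _ _) (h _ _ _ _)) (h _ _ _ _))
    (h _ _ _ _)) (h _ _ _ _)) (h _ _ _ _)) (h _ _ _ _)

theorem phiG2Form_mem_degPart (f : Fin 7 → V) : phiG2Form f ∈ degPart V 3 := by
  have h (i j k : Fin 7) : ExteriorAlgebra.ι ℝ (f i) * ExteriorAlgebra.ι ℝ (f j) *
      ExteriorAlgebra.ι ℝ (f k) ∈ degPart V 3 :=
    mul_mem_degPart (mul_mem_degPart (ι_mem_degPart_one _) (ι_mem_degPart_one _))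
      (ι_mem_degPart_one _)
  exact sub_mem (sub_mem (sub_mem (add_mem (add_mem (add_mem (h _ _ _) (h _ _ _)) (h _ _ _))
    (h _ _ _)) (h _ _ _)) (h _ _ _)) (h _ _ _)

theorem interiorProduct_mem_degPart (X : V) (k : ℕ) {z : ExteriorAlgebra ℝ (Dual ℝ V)}
    (hz : z ∈ degPart (Dual ℝ V) (k + 1)) : interiorProduct X z ∈ degPart (Dual ℝ V) k := by
  induction k generalizing z with
  | zero =>
    rw [degPart, zero_add, pow_one] at hz
    obtain ⟨α, rfl⟩ := hz
    rw [interiorProduct_ι]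
    exact Submodule.smul_mem _ _ one_mem_degPart_zero
  | succ k ih =>
    rw [degPart, pow_succ'] at hz
    induction hz using Submodule.mul_induction_on' with
    | mem_mul_mem m hm y hy =>
      obtain ⟨α, rfl⟩ := hm
      rw [interiorProduct_ι_mul, Nat.add_comm k 1]
      exact sub_mem (Submodule.smul_mem _ _ (by rwa [Nat.add_comm 1 k]))
        (mul_mem_degPart (ι_mem_degPart_one _) (ih hy))
    | add x _ y _ hx hy => rw [map_add]; exact add_mem hx hy

theorem IsContraction.eq_interiorProduct {X : V}
    {c : ExteriorAlgebra ℝ (Dual ℝ V) →ₗ[ℝ] ExteriorAlgebra ℝ (Dual ℝ V)}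
    (hc : IsContraction X c) : c = interiorProduct X := by
  have h1 : c 1 = 0 := by
    have h := hc.1 0 1 one_mem_degPart_zero 1
    simpa using h
  refine LinearMap.ext fun z => ?_
  induction z using CliffordAlgebra.left_induction with
  | algebraMap r =>
    refine Eq.trans ?_ (interiorProduct_algebraMap X r).symm
    rw [Algebra.algebraMap_eq_smul_one, map_smul]
    exact (congrArg (r • ·) h1).trans (smul_zero r)
  | add x y hx hy => rw [map_add, map_add, hx, hy]
  | ι_mul y α ih =>
    refine (hc.1 1 _ (ι_mem_degPart_one α) y).trans
      (Eq.trans ?_ (interiorProduct_ι_mul X α y).symm)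
    rw [hc.2 α, ih, pow_one, neg_one_smul, ← sub_eq_add_neg, ← Algebra.smul_def]

theorem mul_comm_of_mem_degPart_two {z : ExteriorAlgebra ℝ V} (hz : z ∈ degPart V 2)
    (y : ExteriorAlgebra ℝ V) : z * y = y * z := by
  rw [degPart, pow_two] at hz
  induction hz using Submodule.mul_induction_on' with
  | mem_mul_mem m hm n hn =>
    obtain ⟨a, rfl⟩ := hm
    obtain ⟨b, rfl⟩ := hn
    have hsw (u v : V) : ExteriorAlgebra.ι ℝ u * ExteriorAlgebra.ι ℝ v =
        -(ExteriorAlgebra.ι ℝ v * ExteriorAlgebra.ι ℝ u) :=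
      eq_neg_of_add_eq_zero_left (ExteriorAlgebra.ι_add_mul_swap u v)
    induction y using CliffordAlgebra.left_induction with
    | algebraMap r => exact (Algebra.commutes r _).symm
    | add x y hx hy => rw [mul_add, add_mul, hx, hy]
    | ι_mul y c ih =>
      change _ * (ExteriorAlgebra.ι ℝ c * y) = (ExteriorAlgebra.ι ℝ c * y) * _
      rw [mul_assoc (ExteriorAlgebra.ι ℝ c) y, ← ih, ← mul_assoc, ← mul_assoc, mul_assoc _ _
        (ExteriorAlgebra.ι ℝ c), hsw b c, mul_neg, ← mul_assoc, hsw a c]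
      simp only [neg_mul, neg_neg, mul_assoc]
  | add x _ y _ hx hy => rw [add_mul, mul_add, hx, hy]

theorem map_sub_smulRight_apply (X : V) (θ : Dual ℝ V) (z : ExteriorAlgebra ℝ (Dual ℝ V)) :
    ExteriorAlgebra.map (LinearMap.id - (Dual.eval ℝ V X).smulRight θ) z =
      z - ExteriorAlgebra.ι ℝ θ * interiorProduct X z := by
  induction z using CliffordAlgebra.left_induction with
  | algebraMap r =>
    have h := interiorProduct_algebraMap X r
    refine (AlgHom.commutes _ r).trans ?_
    rw [show algebraMap ℝ (CliffordAlgebra _) r =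
      algebraMap ℝ (ExteriorAlgebra ℝ (Dual ℝ V)) r from rfl, h, mul_zero, sub_zero]
  | add x y hx hy => rw [map_add, map_add, hx, hy, mul_add]; abel
  | ι_mul y α ih =>
    change ExteriorAlgebra.map _ (ExteriorAlgebra.ι ℝ α * y) = ExteriorAlgebra.ι ℝ α * y -
      ExteriorAlgebra.ι ℝ θ * interiorProduct X (ExteriorAlgebra.ι ℝ α * y)
    have hθ : ExteriorAlgebra.ι ℝ θ * (ExteriorAlgebra.ι ℝ θ * interiorProduct X y) = 0 := by
      rw [← mul_assoc, ExteriorAlgebra.ι_sq_zero, zero_mul]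
    have hsw : ExteriorAlgebra.ι ℝ α * (ExteriorAlgebra.ι ℝ θ * interiorProduct X y) =
        -(ExteriorAlgebra.ι ℝ θ * (ExteriorAlgebra.ι ℝ α * interiorProduct X y)) := by
      rw [← mul_assoc, eq_neg_of_add_eq_zero_left (ExteriorAlgebra.ι_add_mul_swap α θ), neg_mul,
        mul_assoc]
    rw [map_mul, ih, ExteriorAlgebra.map_apply_ι, interiorProduct_ι_mul]
    simp only [LinearMap.sub_apply, LinearMap.id_apply, LinearMap.smulRight_apply,
      Dual.eval_apply, map_sub, map_smul, sub_mul, mul_sub, smul_mul_assoc, mul_smul_comm, hθ, hsw,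
      smul_zero, sub_zero, sub_neg_eq_add]
    abel

end Interior

section Differential

theorem IsCEDifferential.apply_one {n : ℕ} {b : Basis (Fin n) ℝ g}
    {d : ExteriorAlgebra ℝ (Dual ℝ g) →ₗ[ℝ] ExteriorAlgebra ℝ (Dual ℝ g)}
    (hd : IsCEDifferential b d) : d 1 = 0 := by
  have h := hd.2.1 0 1 one_mem_degPart_zero 1
  simpa using h

theorem interiorProduct_mul_of_mem_degPart_two {V : Type*} [AddCommGroup V] [Module ℝ V] (X : V)
    {z : ExteriorAlgebra ℝ (Dual ℝ V)} (hz : z ∈ degPart (Dual ℝ V) 2)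
    (y : ExteriorAlgebra ℝ (Dual ℝ V)) :
    interiorProduct X (z * y) = interiorProduct X z * y + z * interiorProduct X y := by
  rw [degPart, pow_two] at hz
  induction hz using Submodule.mul_induction_on' with
  | mem_mul_mem m hm n hn =>
    obtain ⟨α, rfl⟩ := hm
    obtain ⟨β, rfl⟩ := hn
    simp only [mul_assoc, interiorProduct_ι_mul, interiorProduct_ι, mul_sub, sub_mul, smul_mul_assoc,
      mul_smul_comm, mul_one]
    abel
  | add x _ y _ hx hy => rw [add_mul, map_add, map_add, hx, hy, add_mul, add_mul]; abel

theorem interiorProduct_differential_ι_of_central {n : ℕ} {b : Basis (Fin n) ℝ g}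
    {d : ExteriorAlgebra ℝ (Dual ℝ g) →ₗ[ℝ] ExteriorAlgebra ℝ (Dual ℝ g)}
    (hd : IsCEDifferential b d) {k : Fin n} (hk : ∀ Y : g, ⁅b k, Y⁆ = 0) (α : Dual ℝ g) :
    interiorProduct (b k) (d (ExteriorAlgebra.ι ℝ α)) = 0 := by
  have hk' (Y : g) : ⁅Y, b k⁆ = 0 := by rw [← lie_skew, hk, neg_zero]
  rw [hd.2.2 α, map_smul, map_sum, Finset.sum_eq_zero, smul_zero]
  intro i _
  rw [map_sum, Finset.sum_eq_zero]
  intro j _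
  rw [map_smul, interiorProduct_ι_mul, interiorProduct_ι, b.dualBasis_apply_self, b.dualBasis_apply_self]
  by_cases hi : k = i
  · subst hi; simp [hk]
  · by_cases hj : k = j
    · subst hj; simp [hk']
    · simp [hi, hj]

/-- Contraction with a central vector anticommutes with the differential. -/
theorem interiorProduct_differential_of_central {n : ℕ} {b : Basis (Fin n) ℝ g}
    {d : ExteriorAlgebra ℝ (Dual ℝ g) →ₗ[ℝ] ExteriorAlgebra ℝ (Dual ℝ g)}
    (hd : IsCEDifferential b d) {k : Fin n} (hk : ∀ Y : g, ⁅b k, Y⁆ = 0)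
    (z : ExteriorAlgebra ℝ (Dual ℝ g)) :
    d (interiorProduct (b k) z) = -interiorProduct (b k) (d z) := by
  induction z using CliffordAlgebra.left_induction with
  | algebraMap r =>
    change d (interiorProduct (b k) (algebraMap ℝ (ExteriorAlgebra ℝ (Dual ℝ g)) r)) =
      -interiorProduct (b k) (d (algebraMap ℝ (ExteriorAlgebra ℝ (Dual ℝ g)) r))
    rw [interiorProduct_algebraMap, Algebra.algebraMap_eq_smul_one, map_smul, hd.apply_one]
    simp
  | add x y hx hy => simp only [map_add, hx, hy, neg_add]
  | ι_mul y α ih =>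
    change d (interiorProduct (b k) (ExteriorAlgebra.ι ℝ α * y)) =
      -interiorProduct (b k) (d (ExteriorAlgebra.ι ℝ α * y))
    have hα := ι_mem_degPart_one α
    rw [interiorProduct_ι_mul, map_sub, map_smul, hd.2.1 1 _ hα, hd.2.1 1 _ hα, map_add,
      interiorProduct_mul_of_mem_degPart_two _ (hd.1 1 _ hα), interiorProduct_differential_ι_of_central hd hk,
      map_smul, interiorProduct_ι_mul, ih]
    simp only [pow_one, neg_smul, one_smul, zero_mul, mul_neg]
    abel

/-- The projection of `g*` onto `h*` along the last basis form. -/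
theorem sub_smulRight_mem_span (b : Basis (Fin 7) ℝ g) (α : Dual ℝ g) :
    ((LinearMap.id : Dual ℝ g →ₗ[ℝ] Dual ℝ g) - (Dual.eval ℝ g (b 6)).smulRight (b.dualBasis 6)) α ∈
      Submodule.span ℝ (Set.range fun i : Fin 6 => b.dualBasis (Fin.castSucc i)) := by
  have hα := b.dualBasis.sum_repr α
  rw [Fin.sum_univ_castSucc] at hα
  have h6 : b.dualBasis.repr α (Fin.last 6) = α (b 6) := b.dualBasis_repr α _
  have h : ((LinearMap.id : Dual ℝ g →ₗ[ℝ] Dual ℝ g) - (Dual.eval ℝ g (b 6)).smulRight (b.dualBasis 6)) α =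
      ∑ i : Fin 6, b.dualBasis.repr α (Fin.castSucc i) • b.dualBasis (Fin.castSucc i) := by
    rw [LinearMap.sub_apply, LinearMap.id_apply, LinearMap.smulRight_apply, Dual.eval_apply, ← h6]
    exact sub_eq_of_eq_add hα.symm
  rw [h]
  exact Submodule.sum_mem _ fun i _ => Submodule.smul_mem _ _ (Submodule.subset_span ⟨i, rfl⟩)

theorem mem_hPart_of_interiorProduct_eq_zero (b : Basis (Fin 7) ℝ g) (k : ℕ)
    {z : ExteriorAlgebra ℝ (Dual ℝ g)} (hz : z ∈ degPart (Dual ℝ g) k)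
    (h : interiorProduct (b 6) z = 0) : z ∈ hPart b k := by
  have hmap := map_sub_smulRight_apply (b 6) (b.dualBasis 6) z
  rw [h, mul_zero, sub_zero] at hmap
  rw [← hmap]
  have hmem := Submodule.mem_map_of_mem (f := (ExteriorAlgebra.map
    (LinearMap.id - (Dual.eval ℝ g (b 6)).smulRight (b.dualBasis 6))).toLinearMap) hz
  rw [degPart, Submodule.map_pow] at hmem
  refine SetLike.le_def.mp
    (pow_le_pow_left' (M := Submodule ℝ (ExteriorAlgebra ℝ (Dual ℝ g))) ?_ k) hmem
  rintro _ ⟨_, ⟨α, rfl⟩, rfl⟩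
  refine ⟨_, ?_, (ExteriorAlgebra.map_apply_ι _ α).symm⟩
  exact sub_smulRight_mem_span b α

end Differential

section Volume

variable {M : Type*} [AddCommGroup M] [Module ℝ M]

/-- The wedge products of two bases are proportional. -/
theorem ιMulti_basis {n : ℕ} (e e' : Basis (Fin n) ℝ M) :
    ExteriorAlgebra.ιMulti ℝ n e' = e.det e' • ExteriorAlgebra.ιMulti ℝ n e := by
  have h : (ExteriorAlgebra.ιMulti ℝ n : M [⋀^Fin n]→ₗ[ℝ] ExteriorAlgebra ℝ M) =
      (LinearMap.toSpanSingleton ℝ _ (ExteriorAlgebra.ιMulti ℝ n e)).compAlternatingMap e.det := by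
    refine Basis.ext_alternating e fun i hi => ?_
    let σ : Equiv.Perm (Fin n) := Equiv.ofBijective i (Finite.injective_iff_bijective.1 hi)
    change ExteriorAlgebra.ιMulti ℝ n (e ∘ σ) = e.det (e ∘ σ) • ExteriorAlgebra.ιMulti ℝ n e
    rw [AlternatingMap.map_perm, AlternatingMap.map_perm, e.det_self, smul_one_smul]
  exact congrArg (fun F : M [⋀^Fin n]→ₗ[ℝ] ExteriorAlgebra ℝ M => F e') h

theorem trace_id_sub_smulRight {n : ℕ} (b : Basis (Fin (n + 1)) ℝ M) (k : Fin (n + 1)) :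
    LinearMap.trace ℝ M (LinearMap.id - (b.dualBasis k).smulRight (b k)) = n := by
  have : Module.Finite ℝ M := Module.Finite.of_basis b
  have : Module.Free ℝ M := Module.Free.of_basis b
  have h : LinearMap.trace ℝ M ((b.dualBasis k).smulRight (b k)) = 1 := by
    have h' : (b.dualBasis k).smulRight (b k) = dualTensorHom ℝ M M (b.dualBasis k ⊗ₜ b k) := by
      ext v; simp
    rw [h', LinearMap.trace_eq_contract_apply, contractLeft_apply, b.dualBasis_apply_self,
      if_pos rfl]
  rw [map_sub, LinearMap.trace_id, h, finrank_eq_card_basis b, Fintype.card_fin]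
  simp

theorem exists_dualBasis_eq {n : ℕ} (b : Basis (Fin n) ℝ M) (f : Basis (Fin n) ℝ (Dual ℝ M)) :
    ∃ F : Basis (Fin n) ℝ M, F.dualBasis = f := by
  have : Module.Finite ℝ M := Module.Finite.of_basis b
  refine ⟨f.dualBasis.map (evalEquiv ℝ M).symm, ?_⟩
  refine DFunLike.ext _ _ fun i => Basis.ext (f.dualBasis.map (evalEquiv ℝ M).symm) fun j => ?_
  rw [Basis.dualBasis_apply_self, Basis.map_apply, apply_evalEquiv_symm_apply,
    Basis.dualBasis_apply_self]
  simp only [eq_comm]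

end Volume

section CrossProduct

variable {V : Type*} [AddCommGroup V] [Module ℝ V]

theorem crossG2_self (x : Fin 7 → ℝ) : crossG2 x x = 0 := by
  ext i
  fin_cases i <;> simp [crossG2] <;> ring

/-- The endomorphism `y ↦ X × y` of a vector space with a basis `F`, where the cross product
is the one for which `F` is a `G₂`-adapted frame. -/
def crossEnd (F : Basis (Fin 7) ℝ V) (X : V) : V →ₗ[ℝ] V :=
  F.equivFun.symm.toLinearMap ∘ₗ
    { toFun := crossG2 (F.equivFun X)
      map_add' := fun y z => by ext i; fin_cases i <;> simp [crossG2] <;> ring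
      map_smul' := fun r y => by ext i; fin_cases i <;> simp [crossG2] <;> ring } ∘ₗ
    F.equivFun.toLinearMap

theorem equivFun_crossEnd (F : Basis (Fin 7) ℝ V) (X y : V) :
    F.equivFun (crossEnd F X y) = crossG2 (F.equivFun X) (F.equivFun y) :=
  F.equivFun.apply_symm_apply _

theorem crossEnd_self (F : Basis (Fin 7) ℝ V) (X : V) : crossEnd F X X = 0 := by
  apply F.equivFun.injective
  rw [equivFun_crossEnd, crossG2_self, map_zero]

theorem crossEnd_crossEnd (F : Basis (Fin 7) ℝ V) (X y : V) :
    crossEnd F X (crossEnd F X y) = (∑ j, F.equivFun X j * F.equivFun y j) • X -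
      (∑ j, F.equivFun X j ^ 2) • y := by
  apply F.equivFun.injective
  ext i
  rw [equivFun_crossEnd, equivFun_crossEnd, crossG2_crossG2]
  simp

theorem dualBasis_apply_eq_equivFun (F : Basis (Fin 7) ℝ V) (X : V) (i : Fin 7) :
    F.dualBasis i X = F.equivFun X i := by
  rw [F.dualBasis_apply, F.equivFun_apply]

theorem sum_sq_smul_starPhiForm (F : Basis (Fin 7) ℝ V) (X : V) :
    (∑ j, F.equivFun X j ^ 2) • starPhiForm (fun i => F.dualBasis i) =
      (2⁻¹ : ℝ) • (interiorProduct X (phiG2Form fun i => F.dualBasis i) *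
        interiorProduct X (phiG2Form fun i => F.dualBasis i)) -
      interiorProduct X (starPhiForm fun i => F.dualBasis i) *
        ExteriorAlgebra.ι ℝ (∑ i, F.equivFun X i • F.dualBasis i) := by
  rw [map_sum]
  simp only [map_smul]
  exact sum_sq_smul_starPhiWord (e := fun i => ExteriorAlgebra.ι ℝ (F.dualBasis i))
    (fun i => ExteriorAlgebra.ι_sq_zero _)
    (fun i j _ => eq_neg_of_add_eq_zero_left (ExteriorAlgebra.ι_add_mul_swap _ _))
    (interiorProduct X) (F.equivFun X) (fun i z => by rw [interiorProduct_ι_mul, dualBasis_apply_eq_equivFun])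
    (fun i => by rw [interiorProduct_ι, dualBasis_apply_eq_equivFun])

theorem interiorProduct_interiorProduct_starPhiForm_mul (F : Basis (Fin 7) ℝ V) (X y : V) :
    interiorProduct y (interiorProduct X (starPhiForm fun i => F.dualBasis i)) *
        interiorProduct X (starPhiForm fun i => F.dualBasis i) =
      (-2 : ℝ) • interiorProduct (crossEnd F X y)
        (interiorProduct X (ExteriorAlgebra.ιMulti ℝ 7 F.dualBasis)) := by
  have hvol : ExteriorAlgebra.ιMulti ℝ 7 F.dualBasis =
      ExteriorAlgebra.ι ℝ (F.dualBasis 0) * (ExteriorAlgebra.ι ℝ (F.dualBasis 1) *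
      (ExteriorAlgebra.ι ℝ (F.dualBasis 2) * (ExteriorAlgebra.ι ℝ (F.dualBasis 3) *
      (ExteriorAlgebra.ι ℝ (F.dualBasis 4) * (ExteriorAlgebra.ι ℝ (F.dualBasis 5) *
      ExteriorAlgebra.ι ℝ (F.dualBasis 6)))))) := by
    rw [ExteriorAlgebra.ιMulti_apply]
    simp [List.ofFn_succ]
  set ρ := interiorProduct X (starPhiForm fun i => F.dualBasis i) with hρ
  set v := interiorProduct X (ExteriorAlgebra.ιMulti ℝ 7 F.dualBasis) with hv
  suffices h : LinearMap.mulRight ℝ ρ ∘ₗ interiorProduct.flip ρ =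
      (-2 : ℝ) • (interiorProduct.flip v ∘ₗ crossEnd F X) from LinearMap.congr_fun h y
  refine F.ext fun k => ?_
  change interiorProduct (F k) ρ * ρ = (-2 : ℝ) • interiorProduct (crossEnd F X (F k)) v
  rw [hv, hvol]
  refine contract_contract_starPhiWord_mul
    (e := fun i => ExteriorAlgebra.ι ℝ (F.dualBasis i))
    (fun i => ExteriorAlgebra.ι_sq_zero _)
    (fun i j _ => eq_neg_of_add_eq_zero_left (ExteriorAlgebra.ι_add_mul_swap _ _))
    (interiorProduct X) (interiorProduct (F k)) (interiorProduct (crossEnd F X (F k)))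
    (F.equivFun X) (F.equivFun (F k)) k (funext fun i => F.equivFun_self k i ▸ ?_)
    ?_ ?_ ?_ ?_ ?_ ?_
  · simp only [eq_comm]
  · intro i z; rw [interiorProduct_ι_mul, dualBasis_apply_eq_equivFun]
  · intro i; rw [interiorProduct_ι, dualBasis_apply_eq_equivFun]
  · intro i z; rw [interiorProduct_ι_mul, dualBasis_apply_eq_equivFun]
  · intro i; rw [interiorProduct_ι, dualBasis_apply_eq_equivFun]
  · intro i z; rw [interiorProduct_ι_mul, dualBasis_apply_eq_equivFun, equivFun_crossEnd]
  · intro i; rw [interiorProduct_ι, dualBasis_apply_eq_equivFun, equivFun_crossEnd]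

end CrossProduct

theorem interiorProduct_ιMulti_dualBasis (b : Basis (Fin 7) ℝ g) :
    interiorProduct (b 6) (ExteriorAlgebra.ιMulti ℝ 7 b.dualBasis) = volH b := by
  rw [ExteriorAlgebra.ιMulti_apply, volH]
  simp [List.ofFn_succ, interiorProduct_ι_mul, interiorProduct_ι]

theorem interiorProduct_starPhiForm_mul_differential {b : Basis (Fin 7) ℝ g}
    {d : ExteriorAlgebra ℝ (Dual ℝ g) →ₗ[ℝ] ExteriorAlgebra ℝ (Dual ℝ g)}
    (hd : IsCEDifferential b d) (hb : ∀ Y : g, ⁅b 6, Y⁆ = 0) (F : Basis (Fin 7) ℝ g)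
    (hF : d (starPhiForm fun i => F.dualBasis i) = 0) :
    interiorProduct (b 6) (starPhiForm fun i => F.dualBasis i) *
        d (ExteriorAlgebra.ι ℝ (∑ i, F.equivFun (b 6) i • F.dualBasis i)) =
      -(interiorProduct (b 6) (phiG2Form fun i => F.dualBasis i) *
        d (interiorProduct (b 6) (phiG2Form fun i => F.dualBasis i))) := by
  have h := congrArg d (sum_sq_smul_starPhiForm F (b 6))
  have hρ : d (interiorProduct (b 6) (starPhiForm fun i => F.dualBasis i)) = 0 := by
    rw [interiorProduct_differential_of_central hd hb, hF, map_zero, neg_zero]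
  have hω := interiorProduct_mem_degPart (b 6) 2 (phiG2Form_mem_degPart fun i => F.dualBasis i)
  have hρ' := interiorProduct_mem_degPart (b 6) 3 (starPhiForm_mem_degPart fun i => F.dualBasis i)
  rw [map_smul, hF, smul_zero, map_sub, map_smul, hd.2.1 2 _ hω, hd.2.1 3 _ hρ', hρ,
    ← mul_comm_of_mem_degPart_two hω] at h
  generalize interiorProduct (b 6) (phiG2Form fun i => F.dualBasis i) *
        d (interiorProduct (b 6) (phiG2Form fun i => F.dualBasis i)) = p at h ⊢
  generalize interiorProduct (b 6) (starPhiForm fun i => F.dualBasis i) *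
        d (ExteriorAlgebra.ι ℝ (∑ i, F.equivFun (b 6) i • F.dualBasis i)) = q at h ⊢
  rw [zero_mul] at h
  refine eq_neg_of_add_eq_zero_left ?_
  rw [h]
  module

theorem sum_sq_equivFun_pos {V : Type*} [AddCommGroup V] [Module ℝ V] (F : Basis (Fin 7) ℝ V)
    {X : V} (hX : X ≠ 0) : 0 < ∑ j, F.equivFun X j ^ 2 := by
  obtain ⟨j, hj⟩ : ∃ j, F.equivFun X j ≠ 0 := by
    by_contra! h
    exact hX (F.equivFun.map_eq_zero_iff.mp (funext h))
  exact Finset.sum_pos' (fun i _ => sq_nonneg _) ⟨j, Finset.mem_univ j, by positivity⟩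

theorem mul_differential_mem_of_mem_span {b : Basis (Fin 7) ℝ g}
    {d : ExteriorAlgebra ℝ (Dual ℝ g) →ₗ[ℝ] ExteriorAlgebra ℝ (Dual ℝ g)}
    {W : Submodule ℝ (ExteriorAlgebra ℝ (Dual ℝ g))} {τ : ExteriorAlgebra ℝ (Dual ℝ g)}
    (h : ∀ j : Fin 6, τ * d (ExteriorAlgebra.ι ℝ (b.dualBasis (Fin.castSucc j))) ∈ W)
    {α : Dual ℝ g}
    (hα : α ∈ Submodule.span ℝ (Set.range fun i : Fin 6 => b.dualBasis (Fin.castSucc i))) :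
    τ * d (ExteriorAlgebra.ι ℝ α) ∈ W := by
  suffices hle : Submodule.span ℝ (Set.range fun i : Fin 6 => b.dualBasis (Fin.castSucc i)) ≤
      W.comap (LinearMap.mulLeft ℝ τ ∘ₗ d ∘ₗ ExteriorAlgebra.ι ℝ) from hle hα
  rw [Submodule.span_le]
  rintro _ ⟨j, rfl⟩
  exact h j

/-- The projection of `g` onto `span(e₁,…,e₆)` along the last basis vector. -/
def projLast (b : Basis (Fin 7) ℝ g) : g →ₗ[ℝ] g :=
  LinearMap.id - (b.dualBasis 6).smulRight (b 6)

theorem projLast_apply (b : Basis (Fin 7) ℝ g) (y : g) :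
    projLast b y = y - b.dualBasis 6 y • b 6 := rfl

theorem projLast_apply_self (b : Basis (Fin 7) ℝ g) : projLast b (b 6) = 0 := by
  rw [projLast_apply, b.dualBasis_apply_self, if_pos rfl, one_smul, sub_self]

theorem projLast_mem_span (b : Basis (Fin 7) ℝ g) (y : g) :
    projLast b y ∈ Submodule.span ℝ (Set.range fun i : Fin 6 => b (Fin.castSucc i)) := by
  have hy := b.sum_repr y
  rw [Fin.sum_univ_castSucc] at hy
  have h : projLast b y = ∑ i : Fin 6, b.repr y (Fin.castSucc i) • b (Fin.castSucc i) := by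
    rw [projLast_apply, b.dualBasis_apply]
    exact sub_eq_of_eq_add hy.symm
  rw [h]
  exact Submodule.sum_mem _ fun i _ => Submodule.smul_mem _ _ (Submodule.subset_span ⟨i, rfl⟩)

theorem interiorProduct_projLast_volH (b : Basis (Fin 7) ℝ g) (y : g) :
    interiorProduct (projLast b y) (volH b) = interiorProduct y (volH b) := by
  have h : interiorProduct (b 6) (volH b) = 0 := by
    rw [← interiorProduct_ιMulti_dualBasis, interiorProduct_interiorProduct]
  rw [projLast_apply, map_sub, map_smul, LinearMap.sub_apply, LinearMap.smul_apply, h, smul_zero,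
    sub_zero]

theorem trace_projLast_crossEnd_sq (b F : Basis (Fin 7) ℝ g) :
    LinearMap.trace ℝ g ((projLast b ∘ₗ crossEnd F (b 6)) ∘ₗ (projLast b ∘ₗ crossEnd F (b 6))) =
      -(6 * ∑ j, F.equivFun (b 6) j ^ 2) := by
  have h : (projLast b ∘ₗ crossEnd F (b 6)) ∘ₗ (projLast b ∘ₗ crossEnd F (b 6)) =
      -(∑ j, F.equivFun (b 6) j ^ 2) • projLast b := by
    refine LinearMap.ext fun y => ?_
    change projLast b (crossEnd F (b 6) (projLast b (crossEnd F (b 6) y))) =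
      -(∑ j, F.equivFun (b 6) j ^ 2) • projLast b y
    rw [projLast_apply b (crossEnd F (b 6) y), map_sub, map_smul, crossEnd_self, smul_zero,
      sub_zero, crossEnd_crossEnd, map_sub, map_smul, projLast_apply_self, smul_zero, zero_sub,
      map_smul, neg_smul]
  have ht : LinearMap.trace ℝ g (projLast b) = 6 := by
    refine (trace_id_sub_smulRight b 6).trans ?_
    norm_num
  rw [h, map_smul, ht, smul_eq_mul]
  ring

/-- Proposition `prop:third`, the third obstruction.  Let `g` be 7-dimensional
with `e₇` central and `h* = span(e¹,…,e⁶)`.  Suppose `W ⊆ Λ⁵h*` satisfies: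
(i) `β ∧ dβ ∈ W` for every `β ∈ Λ²h*`; (ii) `τ ∧ de^j ∈ W` for every `d`-closed `τ ∈ Λ³h*`
and every `j = 1,…,6`.  If every `d`-closed `τ ∈ Λ³h*` with `τ ∧ de⁷ ∈ W` has nonnegative
Hitchin invariant `λ(τ) = (1/6)tr(K_τ²) ≥ 0` (computed on the 6-dimensional space
`V = span(e₁,…,e₆)`, with `K_τ` determined by `ι_{K_τ x}(e¹∧⋯∧e⁶) = ι_x τ ∧ τ` on `V`),
then `g` does not admit a coclosed G₂-structure. -/
theorem third_obstruction
    (b : Basis (Fin 7) ℝ g) (hcentral : ∀ Y : g, ⁅b 6, Y⁆ = 0)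
    (d : ExteriorAlgebra ℝ (Dual ℝ g) →ₗ[ℝ] ExteriorAlgebra ℝ (Dual ℝ g))
    (hd : IsCEDifferential b d)
    (C : g → (ExteriorAlgebra ℝ (Dual ℝ g) →ₗ[ℝ] ExteriorAlgebra ℝ (Dual ℝ g)))
    (hC : ∀ x : g, IsContraction x (C x))
    (W : Submodule ℝ (ExteriorAlgebra ℝ (Dual ℝ g))) (hW : W ≤ hPart b 5)
    (hi : ∀ β ∈ hPart b 2, β * d β ∈ W)
    (hii : ∀ τ ∈ hPart b 3, d τ = 0 →
      ∀ j : Fin 6, τ * d (ExteriorAlgebra.ι ℝ (b.dualBasis (Fin.castSucc j))) ∈ W)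
    (hlam : ∀ τ ∈ hPart b 3, d τ = 0 →
      τ * d (ExteriorAlgebra.ι ℝ (b.dualBasis 6)) ∈ W →
      ∀ K : g →ₗ[ℝ] g, K (b 6) = 0 →
        (∀ x ∈ Submodule.span ℝ (Set.range fun i : Fin 6 => b (Fin.castSucc i)),
          K x ∈ Submodule.span ℝ (Set.range fun i : Fin 6 => b (Fin.castSucc i))) →
        (∀ x ∈ Submodule.span ℝ (Set.range fun i : Fin 6 => b (Fin.castSucc i)),
          C (K x) (volH b) = C x τ * τ) →
        0 ≤ (6⁻¹ : ℝ) * LinearMap.trace ℝ g (K ∘ₗ K)) :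
    ¬ ∃ f : Basis (Fin 7) ℝ (Dual ℝ g), d (starPhiForm fun i => f i) = 0 := by
  rintro ⟨f, hf⟩
  obtain ⟨F, rfl⟩ := exists_dualBasis_eq b f
  have hN := sum_sq_equivFun_pos F (b.ne_zero 6)
  set N := ∑ j, F.equivFun (b 6) j ^ 2 with hNdef
  set η := ∑ i, F.equivFun (b 6) i • F.dualBasis i with hη
  set ω := interiorProduct (b 6) (phiG2Form fun i => F.dualBasis i) with hω
  set ρ := interiorProduct (b 6) (starPhiForm fun i => F.dualBasis i) with hρ
  have hωmem : ω ∈ hPart b 2 := mem_hPart_of_interiorProduct_eq_zero b 2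
    (interiorProduct_mem_degPart _ 2 (phiG2Form_mem_degPart _))
    (interiorProduct_interiorProduct _ _)
  have hρmem : ρ ∈ hPart b 3 := mem_hPart_of_interiorProduct_eq_zero b 3
    (interiorProduct_mem_degPart _ 3 (starPhiForm_mem_degPart _))
    (interiorProduct_interiorProduct _ _)
  have hdρ : d ρ = 0 := by
    rw [hρ, interiorProduct_differential_of_central hd hcentral, hf, map_zero, neg_zero]
  have hηX : η (b 6) = N := by
    rw [hη, hNdef, LinearMap.sum_apply]
    refine Finset.sum_congr rfl fun i _ => ?_
    rw [LinearMap.smul_apply, dualBasis_apply_eq_equivFun, smul_eq_mul, sq]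
  have hρη : ρ * d (ExteriorAlgebra.ι ℝ η) ∈ W := by
    rw [interiorProduct_starPhiForm_mul_differential hd hcentral F hf]
    exact W.neg_mem (hi ω hωmem)
  have hρe : ρ * d (ExteriorAlgebra.ι ℝ (b.dualBasis 6)) ∈ W := by
    have hα := mul_differential_mem_of_mem_span (hii ρ hρmem hdρ) (sub_smulRight_mem_span b η)
    have hsub := W.sub_mem hρη hα
    rw [← mul_sub, ← map_sub, ← map_sub, LinearMap.sub_apply, LinearMap.id_apply, sub_sub_cancel,
      LinearMap.smulRight_apply, Dual.eval_apply, hηX, map_smul, map_smul, mul_smul_comm] at hsub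
    exact (W.smul_mem_iff hN.ne').mp hsub
  set c : ℝ := -2 * b.dualBasis.det F.dualBasis with hc
  have hc0 : c ≠ 0 := mul_ne_zero (by norm_num) (b.dualBasis.isUnit_det F.dualBasis).ne_zero
  have hK := hlam ρ hρmem hdρ hρe (c • (projLast b ∘ₗ crossEnd F (b 6)))
    (by rw [LinearMap.smul_apply, LinearMap.comp_apply, crossEnd_self, map_zero, smul_zero])
    (fun x _ => Submodule.smul_mem _ _ (projLast_mem_span b _))
    (fun x _ => by
      rw [(hC _).eq_interiorProduct, (hC x).eq_interiorProduct,
        interiorProduct_interiorProduct_starPhiForm_mul, ιMulti_basis b.dualBasis F.dualBasis,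
        map_smul, map_smul, smul_smul, interiorProduct_ιMulti_dualBasis, LinearMap.smul_apply,
        map_smul, LinearMap.smul_apply, LinearMap.comp_apply, interiorProduct_projLast_volH])
  rw [LinearMap.smul_comp, LinearMap.comp_smul, map_smul, map_smul, trace_projLast_crossEnd_sq,
    smul_eq_mul, smul_eq_mul] at hK
  have hpos : 0 < c * c * N := mul_pos (mul_self_pos.mpr hc0) hN
  linarith
end
end
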